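/- There is no smooth integral non-degenerate variety X ⊂ P^r of dimension n with 2 ≤ n < r admitting an injective morphism ℓ₁ : X ∖ S → P^n (S a finite set of a−1 ≥ 1 points) arising as a linear projection which is an open immersion onto its image: such a map would force X ≅ P^n as an abstract variety and would lift to a morphism from the blow-up of X at S to P^n, which cannot exist for n > 1 since any morphism P^n → P^n injective outside a finite set is an isomorphism. -/

import Mathlib

open MvPolynomial

noncomputable section

namespace Dep

variable (K : Type) [Field K]

/-- `PS K n` is the projective space of lines in `K^n`, i.e. `ℙ^{n-1}`. -/
abbrev PS (n : ℕ) := Projectivization K (Fin n → K)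

/-- The projective zero locus of a (homogeneous) polynomial. -/
def zeros {n : ℕ} (f : MvPolynomial (Fin n) K) : Set (PS K n) :=
  {p | ∀ v : Fin n → K, ∀ hv : v ≠ 0, Projectivization.mk K v hv = p → eval v f = 0}

/-- Zariski-closed subsets of projective space: common zero loci of families of
homogeneous polynomials. -/
def IsZClosed {n : ℕ} (X : Set (PS K n)) : Prop :=
  ∃ F : Set (MvPolynomial (Fin n) K), (∀ f ∈ F, ∃ d, f.IsHomogeneous d) ∧
    X = ⋂ f ∈ F, zeros K f

/-- Irreducible closed subsets. -/
def IsIrredClosed {n : ℕ} (X : Set (PS K n)) : Prop :=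
  X.Nonempty ∧ IsZClosed K X ∧
    ∀ C₁ C₂ : Set (PS K n), IsZClosed K C₁ → IsZClosed K C₂ → X ⊆ C₁ ∪ C₂ →
      X ⊆ C₁ ∨ X ⊆ C₂

/-- Zariski closure. -/
def zclosure {n : ℕ} (S : Set (PS K n)) : Set (PS K n) :=
  ⋂₀ {C | IsZClosed K C ∧ S ⊆ C}

/-- Dimension of a subset of projective space: the supremum of lengths of strict chains
of irreducible closed subsets contained in it. -/
def zdim {n : ℕ} (X : Set (PS K n)) : ℕ :=
  sSup {m | ∃ C : Fin (m + 1) → Set (PS K n),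
    (∀ i, IsIrredClosed K (C i) ∧ C i ⊆ X) ∧
    ∀ i j : Fin (m + 1), i < j → C i ⊂ C j}

/-- The linear subspace of `K^n` spanned by (representatives of) a set of projective points. -/
def projSpan {n : ℕ} (S : Set (PS K n)) : Submodule K (Fin n → K) :=
  Submodule.span K (Projectivization.rep '' S)

/-- The projective linear span of a set of projective points, as a set of points. -/
def spanSet {n : ℕ} (S : Set (PS K n)) : Set (PS K n) :=
  {p | p.rep ∈ projSpan K S}

/-- Non-degenerate: not contained in any hyperplane, i.e. the points span everything. -/
def Nondeg {n : ℕ} (X : Set (PS K n)) : Prop := projSpan K X = ⊤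

/-- An integral non-degenerate projective variety in `ℙ^{n-1}`. -/
def IsVariety {n : ℕ} (X : Set (PS K n)) : Prop :=
  IsIrredClosed K X ∧ Nondeg K X

/-- A finite set of projective points is linearly independent if its span has dimension
(as a vector subspace) equal to its cardinality. -/
def LinIndepSet {n : ℕ} (S : Finset (PS K n)) : Prop :=
  Module.finrank K (projSpan K (S : Set (PS K n))) = S.card

/-- `ρ'(X)`: the maximal `t > 0` such that every subset of `X` with at most `t` points is
linearly independent. -/
def rho' {n : ℕ} (X : Set (PS K n)) : ℕ :=
  sSup {t | 0 < t ∧ ∀ S : Finset (PS K n), ↑S ⊆ X → S.card ≤ t → LinIndepSet K S}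

/- ### Zero-dimensional subschemes, via homogeneous ideals -/

/-- A homogeneous ideal. -/
def IsHomogIdeal {n : ℕ} (I : Ideal (MvPolynomial (Fin n) K)) : Prop :=
  ∀ f ∈ I, ∀ d : ℕ, homogeneousComponent d f ∈ I

/-- The homogeneous vanishing ideal of a set of projective points. -/
def hVanish {n : ℕ} (S : Set (PS K n)) : Ideal (MvPolynomial (Fin n) K) :=
  Ideal.span {f | (∃ d, f.IsHomogeneous d) ∧ S ⊆ zeros K f}

/-- The Hilbert function of (the subscheme defined by) a homogeneous ideal: the dimension of
the degree-`m` graded piece of the quotient ring. -/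
def hilb {n : ℕ} (I : Ideal (MvPolynomial (Fin n) K)) (m : ℕ) : ℕ :=
  Module.finrank K (Submodule.map (Ideal.Quotient.mkₐ K I).toLinearMap
    (homogeneousSubmodule (Fin n) K m))

/-- The subscheme defined by `I` is zero-dimensional of degree `d`: the Hilbert function is
eventually constant, equal to `d`. -/
def SchemeDeg {n : ℕ} (I : Ideal (MvPolynomial (Fin n) K)) (d : ℕ) : Prop :=
  ∃ N, ∀ m ≥ N, hilb K I m = d

/-- The subscheme defined by `I` lies in `X`. -/
def SubschemeOf {n : ℕ} (X : Set (PS K n)) (I : Ideal (MvPolynomial (Fin n) K)) : Prop :=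
  hVanish K X ≤ I

/-- The degree-one part of a homogeneous ideal, i.e. the linear forms vanishing on the
corresponding subscheme. -/
def degOnePart {n : ℕ} (I : Ideal (MvPolynomial (Fin n) K)) :
    Submodule K (MvPolynomial (Fin n) K) :=
  homogeneousSubmodule (Fin n) K 1 ⊓ I.restrictScalars K

/-- A zero-dimensional subscheme of degree `d` of `ℙ^{n-1}` is linearly independent iff its
projective span has dimension `d - 1`, i.e. exactly `n - d` independent linear forms vanish
on it. -/
def SchemeLinIndep {n : ℕ} (I : Ideal (MvPolynomial (Fin n) K)) (d : ℕ) : Prop :=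
  Module.finrank K (degOnePart K I) = n - d

/-- The projective linear span of the subscheme defined by `I`: the common zero locus of the
linear forms in `I`. -/
def schemeSpan {n : ℕ} (I : Ideal (MvPolynomial (Fin n) K)) : Set (PS K n) :=
  {p | ∀ f ∈ I, f.IsHomogeneous 1 → p ∈ zeros K f}

/-- The set-theoretic zero locus of an ideal. -/
def idealZeros {n : ℕ} (I : Ideal (MvPolynomial (Fin n) K)) : Set (PS K n) :=
  {p | ∀ f ∈ I, ∀ m : ℕ, p ∈ zeros K (homogeneousComponent m f)}

/-- The subscheme defined by `I` is reduced: `I` is the full vanishing ideal of its zero set. -/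
def IsReducedScheme {n : ℕ} (I : Ideal (MvPolynomial (Fin n) K)) : Prop :=
  I = hVanish K (idealZeros K I)

/- ### Smoothability: flat limits of reduced finite subsets -/

/-- Specialisation of a one-parameter family of ideals at `c : K`. -/
def fiberAt {n : ℕ} (J : Ideal (MvPolynomial (Fin n) (Polynomial K))) (c : K) :
    Ideal (MvPolynomial (Fin n) K) :=
  Ideal.map (MvPolynomial.map (Polynomial.evalRingHom c)) J

/-- `Z` (given by `I`, of degree `d`) is smoothable in `X`: either `Z` is already a reduced set
of `d` points of `X`, or `Z` is the flat limit at `0` of a one-parameter family whose general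
member is a reduced set of `d` points of `X`.  Flatness over `K[t]` is encoded as
torsion-freeness of the quotient. -/
def SmoothableIn {n : ℕ} (X : Set (PS K n)) (I : Ideal (MvPolynomial (Fin n) K)) (d : ℕ) :
    Prop :=
  (∃ S : Finset (PS K n), ↑S ⊆ X ∧ S.card = d ∧ I = hVanish K (S : Set (PS K n))) ∨
  ∃ J : Ideal (MvPolynomial (Fin n) (Polynomial K)),
    (∀ f ∈ J, ∀ m : ℕ, homogeneousComponent m f ∈ J) ∧
    (∀ p : Polynomial K, p ≠ 0 → ∀ f, MvPolynomial.C p * f ∈ J → f ∈ J) ∧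
    fiberAt K J 0 = I ∧
    ∃ E : Set K, E.Finite ∧ ∀ c : K, c ∉ E →
      ∃ S : Finset (PS K n), ↑S ⊆ X ∧ S.card = d ∧
        fiberAt K J c = hVanish K (S : Set (PS K n))

/-- `ρ''(X)`: the maximal `t > 0` such that every zero-dimensional subscheme of `X` of degree
at most `t` which is smoothable in `X` is linearly independent. -/
def rho'' {n : ℕ} (X : Set (PS K n)) : ℕ :=
  sSup {t | 0 < t ∧ ∀ (I : Ideal (MvPolynomial (Fin n) K)) (d : ℕ),
    IsHomogIdeal K I → SubschemeOf K X I → SchemeDeg K I d → SmoothableIn K X I d →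
    d ≤ t → SchemeLinIndep K I d}

/-- `ρ(X)`: the maximal `t > 0` such that every zero-dimensional subscheme of `X` of degree
at most `t` is linearly independent. -/
def rho {n : ℕ} (X : Set (PS K n)) : ℕ :=
  sSup {t | 0 < t ∧ ∀ (I : Ideal (MvPolynomial (Fin n) K)) (d : ℕ),
    IsHomogIdeal K I → SubschemeOf K X I → SchemeDeg K I d →
    d ≤ t → SchemeLinIndep K I d}

/- ### Ranks and secant varieties -/

/-- The `X`-rank of a point `q`. -/
def Xrank {n : ℕ} (X : Set (PS K n)) (q : PS K n) : ℕ :=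
  sInf {t | 0 < t ∧ ∃ S : Finset (PS K n), ↑S ⊆ X ∧ S.card = t ∧ q ∈ spanSet K ↑S}

/-- `𝒮(X,q)`: the set of finite subsets of `X` of minimal cardinality whose span contains `q`. -/
def Sq {n : ℕ} (X : Set (PS K n)) (q : PS K n) : Set (Finset (PS K n)) :=
  {S | ↑S ⊆ X ∧ S.card = Xrank K X q ∧ q ∈ spanSet K ↑S}

/-- The `k`-th secant variety of `X`. -/
def secant {n : ℕ} (X : Set (PS K n)) (k : ℕ) : Set (PS K n) :=
  zclosure K (⋃ S ∈ {S : Finset (PS K n) | ↑S ⊆ X ∧ S.card = k}, spanSet K (S : Set (PS K n)))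

/-- The generic `X`-rank: the least `k` with `σ_k(X) = ℙ^{n-1}`. -/
def genRank {n : ℕ} (X : Set (PS K n)) : ℕ :=
  sInf {k | 0 < k ∧ secant K X k = Set.univ}

/-- The border `X`-rank of a point. -/
def borderRank {n : ℕ} (X : Set (PS K n)) (q : PS K n) : ℕ :=
  sInf {k | 0 < k ∧ q ∈ secant K X k}

/-- `X ⊆ ℙ^{m-1}` of dimension `dX` is not defective: every secant variety has the expected
dimension. -/
def NotDefective {m : ℕ} (X : Set (PS K m)) (dX : ℕ) : Prop :=
  ∀ k : ℕ, 0 < k → zdim K (secant K X k) = min (m - 1) (k * (dX + 1) - 1)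

/- ### Rational normal curves -/

/-- `X ⊆ ℙ^{n-1}` is a rational normal curve: up to a linear change of coordinates it is the
image of `ℙ^1` under the degree-`(n-1)` Veronese map. -/
def IsRNC {n : ℕ} (X : Set (PS K n)) : Prop :=
  ∃ g : (Fin n → K) ≃ₗ[K] (Fin n → K),
    X = {p | ∃ v : Fin 2 → K,
      ∃ hv : g (fun i => v 0 ^ (i : ℕ) * v 1 ^ (n - 1 - (i : ℕ))) ≠ 0,
      p = Projectivization.mk K (g (fun i => v 0 ^ (i : ℕ) * v 1 ^ (n - 1 - (i : ℕ)))) hv}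

/- ### Linear projections and linear normality -/

/-- The pull-back map on polynomials induced by a linear map `π : K^{n+1} → K^n`. -/
def pullback {n m : ℕ} (π : (Fin m → K) →ₗ[K] (Fin n → K)) :
    MvPolynomial (Fin n) K →ₐ[K] MvPolynomial (Fin m) K :=
  aeval (fun i => ∑ j : Fin m, MvPolynomial.C (π (Pi.single j 1) i) * MvPolynomial.X j)

/-- The image of a set of points under the projection induced by `π`. -/
def projImage {n m : ℕ} (π : (Fin m → K) →ₗ[K] (Fin n → K)) (Y : Set (PS K m)) :
    Set (PS K n) :=
  {q | ∃ p ∈ Y, ∃ h : π p.rep ≠ 0, q = Projectivization.mk K (π p.rep) h}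

/-- The linear projection from the point `o` (encoded by the linear map `π` with kernel the
line of `o`) restricts to an embedding of `Y`: `o ∉ Y` and `o` lies on no secant or tangent
line of `Y`, i.e. on the span of no degree-2 subscheme of `Y`. -/
def EmbedsFrom {n : ℕ} (π : (Fin (n + 1) → K) →ₗ[K] (Fin n → K)) (o : PS K (n + 1))
    (Y : Set (PS K (n + 1))) : Prop :=
  Function.Surjective π ∧
  LinearMap.ker π = Submodule.span K {o.rep} ∧ o ∉ Y ∧
  ∀ I : Ideal (MvPolynomial (Fin (n + 1)) K),
    IsHomogIdeal K I → SubschemeOf K Y I → SchemeDeg K I 2 → o ∉ schemeSpan K I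

/-- `X ⊆ ℙ^{n-1}` is linearly normal: it is not an isomorphic linear projection of a
non-degenerate variety in `ℙ^n`. -/
def LinearlyNormal {n : ℕ} (X : Set (PS K n)) : Prop :=
  ¬ ∃ (Y : Set (PS K (n + 1))) (o : PS K (n + 1))
      (π : (Fin (n + 1) → K) →ₗ[K] (Fin n → K)),
      IsVariety K Y ∧ EmbedsFrom K π o Y ∧ projImage K π Y = X

/- ### Tangent spaces and smooth points -/

/-- The (affine cone over the) embedded tangent space of `X` at `p`: the common kernel of the
differentials at `p` of all elements of the vanishing ideal of `X`. -/
def tangentSub {n : ℕ} (X : Set (PS K n)) (p : PS K n) : Submodule K (Fin n → K) :=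
  ⨅ f ∈ hVanish K X, LinearMap.ker
    (∑ j : Fin n, eval p.rep (pderiv j f) • (LinearMap.proj j : (Fin n → K) →ₗ[K] K))

/-- `p` is a smooth point of `X`. -/
def SmoothAt {n : ℕ} (X : Set (PS K n)) (p : PS K n) : Prop :=
  p ∈ X ∧ Module.finrank K (tangentSub K X p) = zdim K X + 1

/-- A smooth integral non-degenerate projective variety. -/
def SmoothVariety {n : ℕ} (X : Set (PS K n)) : Prop :=
  IsVariety K X ∧ ∀ p ∈ X, SmoothAt K X p


theorem aux_dim_eq (K D : Type) [Field K] [CommRing D] [IsDomain D] [Algebra K D]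
    [Algebra.FiniteType K D] : ∃ s : ℕ, Algebra.trdeg K D = s ∧ ringKrullDim D = s := by
  obtain ⟨s, g, hinj, hintegral⟩ := exists_integral_inj_algHom_of_fg K D
  refine ⟨s, ?_, ?_⟩
  · let := g.toRingHom.toAlgebra
    have : IsScalarTower K (MvPolynomial (Fin s) K) D :=
      IsScalarTower.of_algebraMap_eq (fun x => (g.commutes x).symm)
    have : Algebra.IsIntegral (MvPolynomial (Fin s) K) D := ⟨hintegral⟩
    have : FaithfulSMul (MvPolynomial (Fin s) K) D :=
      (faithfulSMul_iff_algebraMap_injective _ _).2 hinj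
    rw [← trdeg_add_eq K (MvPolynomial (Fin s) K) (A := D), trdeg_eq_zero (R := MvPolynomial (Fin s) K) (A := D),
      MvPolynomial.trdeg_of_isDomain]
    simp
  · let := g.toRingHom.toAlgebra
    have : Algebra.IsIntegral (MvPolynomial (Fin s) K) D := ⟨hintegral⟩
    have : FaithfulSMul (MvPolynomial (Fin s) K) D :=
      (faithfulSMul_iff_algebraMap_injective _ _).2 hinj
    have hs : ringKrullDim (MvPolynomial (Fin s) K) = s := by
      rw [MvPolynomial.ringKrullDim_of_isNoetherianRing]; simp
    rw [← hs]
    apply le_antisymm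
    · refine Order.krullDim_le_of_strictMono
        (PrimeSpectrum.comap (algebraMap (MvPolynomial (Fin s) K) D)) ?_
      intro P Q hPQ
      exact Ideal.IsIntegral.comap_lt_comap (R := MvPolynomial (Fin s) K)
        (I := P.asIdeal) (J := Q.asIdeal) hPQ
    · refine iSup_le fun l => ?_
      have : (⊥ : Ideal D).LiesOver (⊥ : Ideal (MvPolynomial (Fin s) K)) := by
        constructor
        ext x
        simp [Ideal.under]
      obtain ⟨Q, hQ, hQ2⟩ := Ideal.exists_ideal_over_prime_of_isIntegral_of_isDomain (S := D) l.head.asIdeal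
        (by rw [(RingHom.injective_iff_ker_eq_bot (algebraMap (MvPolynomial (Fin s) K) D)).1 hinj]; exact bot_le)
      have := hQ
      have : Q.LiesOver l.head.asIdeal := ⟨hQ2.symm⟩
      obtain ⟨L, hL, -⟩ := Ideal.exists_ltSeries_of_hasGoingUp l Q
      rw [← hL]
      exact le_iSup (fun p : LTSeries (PrimeSpectrum D) => (p.length : WithBot ℕ∞)) L

theorem aux_amalg (E L Ω : Type) [Field E] [Field L] [Field Ω] (f : E →+* L) (σ : E →+* Ω) :
    ∃ (M : Type) (_ : Field M) (k₁ : Ω →+* M) (k₂ : L →+* M), ∀ e, k₂ (f e) = k₁ (σ e) := by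
  let _ : Algebra E Ω := σ.toAlgebra
  let _ : Algebra E L := f.toAlgebra
  obtain ⟨m, hm⟩ := Ideal.exists_maximal (TensorProduct E Ω L)
  let _ : Field (TensorProduct E Ω L ⧸ m) := Ideal.Quotient.field m
  refine ⟨TensorProduct E Ω L ⧸ m, inferInstance, (Ideal.Quotient.mk m).comp
    (Algebra.TensorProduct.includeLeftRingHom), (Ideal.Quotient.mk m).comp
    ((Algebra.TensorProduct.includeRight : L →ₐ[E] TensorProduct E Ω L) :
      L →+* TensorProduct E Ω L), fun e => ?_⟩
  change Ideal.Quotient.mk m _ = Ideal.Quotient.mk m _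
  congr 1
  exact ((Algebra.TensorProduct.includeRight : L →ₐ[E] TensorProduct E Ω L).commutes e).trans
      ((Algebra.TensorProduct.includeLeft : Ω →ₐ[E] TensorProduct E Ω L).commutes e).symm

theorem aux_two_emb (F L : Type) [Field F] [CharZero F] [Field L] [Algebra F L] (z : L)
    (hz : z ∉ (algebraMap F L).range) :
    ∃ (M : Type) (_ : Field M) (_ : Algebra F M) (j₁ j₂ : L →ₐ[F] M), j₁ z ≠ j₂ z := by
  classical
  let Ω := AlgebraicClosure L
  let w : Ω := algebraMap L Ω z
  obtain ⟨σ, hσ⟩ : ∃ σ : IntermediateField.adjoin F {z} →ₐ[F] Ω,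
      σ (IntermediateField.AdjoinSimple.gen F z) ≠ w := by
    by_cases ht : Transcendental F z
    · have ht' : Transcendental F (z + 1) := by
        intro h
        apply ht
        have := h.sub (isAlgebraic_one (R := F) (A := L))
        simpa using this
      refine ⟨(IsScalarTower.toAlgHom F L Ω).comp
        ((IntermediateField.val _).comp
          (((RatFunc.algEquivOfTranscendental z ht).symm.trans
          (RatFunc.algEquivOfTranscendental (z + 1) ht')).toAlgHom)), ?_⟩
      have h1 : (RatFunc.algEquivOfTranscendental z ht).symm
          (IntermediateField.AdjoinSimple.gen F z) = RatFunc.X := by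
        rw [AlgEquiv.symm_apply_eq]
        apply Subtype.ext
        simp
      simp [h1, w]
    · have hi : IsIntegral F z := (not_not.1 ht : IsAlgebraic F z).isIntegral
      have hsep : (minpoly F z).Separable := (minpoly.irreducible hi).separable
      have hcard : Fintype.card ((minpoly F z).rootSet Ω) = (minpoly F z).natDegree :=
        Polynomial.card_rootSet_eq_natDegree hsep (IsAlgClosed.splits _)
      have hdeg : 1 < (minpoly F z).natDegree := by
        by_contra hle
        have h1 : (minpoly F z).natDegree = 1 := le_antisymm (not_lt.1 hle) (minpoly.natDegree_pos hi)
        exact hz (minpoly.mem_range_of_degree_eq_one F z (by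
          rw [Polynomial.degree_eq_natDegree (minpoly.ne_zero hi), h1]; rfl))
      have hw : w ∈ (minpoly F z).rootSet Ω := by
        rw [Polynomial.mem_rootSet]
        refine ⟨minpoly.ne_zero hi, ?_⟩
        simp [w, Polynomial.aeval_algebraMap_apply]
      obtain ⟨y, hy⟩ := Fintype.exists_ne_of_one_lt_card (hcard ▸ hdeg) (⟨w, hw⟩ : (minpoly F z).rootSet Ω)
      have hy2 := y.2
      let pb := IntermediateField.adjoin.powerBasis hi
      refine ⟨pb.lift y.1 ?_, ?_⟩
      · rw [Polynomial.mem_rootSet] at hy2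
        have : minpoly F pb.gen = minpoly F z := by
          simp [pb, IntermediateField.adjoin.powerBasis_gen, IntermediateField.minpoly_gen]
        rw [this]; exact hy2.2
      · have := pb.lift_gen y.1 (by
          rw [Polynomial.mem_rootSet] at hy2
          have : minpoly F pb.gen = minpoly F z := by
            simp [pb, IntermediateField.adjoin.powerBasis_gen, IntermediateField.minpoly_gen]
          rw [this]; exact hy2.2)
        simp only [pb, IntermediateField.adjoin.powerBasis_gen] at this
        rw [this]
        intro h
        exact hy (Subtype.ext h)
  let E := IntermediateField.adjoin F {z}
  obtain ⟨M, _, k₁, k₂, hk⟩ := aux_amalg E L Ω (algebraMap E L) σ.toRingHom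
  let _ : Algebra F (M) := (k₁.comp (algebraMap F Ω)).toAlgebra
  refine ⟨M, inferInstance, inferInstance,
    { toRingHom := k₁.comp (algebraMap L Ω), commutes' := fun x => ?_ },
    { toRingHom := k₂, commutes' := fun x => ?_ }, ?_⟩
  · change k₁ (algebraMap L Ω (algebraMap F L x)) = k₁ (algebraMap F Ω x)
    rw [← IsScalarTower.algebraMap_apply]
  · change k₂ (algebraMap F L x) = k₁ (algebraMap F Ω x)
    rw [← σ.commutes x]
    exact hk (algebraMap F E x)
  · change k₁ w ≠ k₂ z
    have h2 : k₂ z = k₁ (σ (IntermediateField.AdjoinSimple.gen F z)) :=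
      hk (IntermediateField.AdjoinSimple.gen F z)
    rw [h2]
    exact fun h => hσ (k₁.injective h).symm

/-- Two points of a domain `D` agreeing on a subalgebra `A` but separated by `z`. -/
theorem aux_two_points (K D : Type) [Field K] [IsAlgClosed K] [CharZero K] [CommRing D] [IsDomain D]
    [Algebra K D] [Algebra.FiniteType K D] (A : Subalgebra K D) (z g : D) (hg : g ≠ 0)
    (hz : ∀ a ∈ A, ∀ b ∈ A, b ≠ 0 → z * b ≠ a) :
    ∃ φ ψ : D →ₐ[K] K, (∀ a ∈ A, φ a = ψ a) ∧ φ z ≠ ψ z ∧ φ g ≠ 0 ∧ ψ g ≠ 0 := by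
  let L := FractionRing D
  let i : D →ₐ[K] L := IsScalarTower.toAlgHom K D L
  have hi : Function.Injective i := IsFractionRing.injective D L
  let F := IntermediateField.adjoin K (i '' (A : Set D))
  have hzF : i z ∉ (algebraMap F L).range := by
    rintro ⟨x, hx⟩
    have hx2 : i z ∈ F := by rw [← hx]; exact x.2
    rw [IntermediateField.mem_adjoin_iff_div] at hx2
    have hA : Algebra.adjoin K (i '' (A : Set D)) = A.map i := by
      rw [← AlgHom.map_adjoin, Algebra.adjoin_eq]
    rw [hA] at hx2
    obtain ⟨_, ⟨a, ha, rfl⟩, _, ⟨b, hb, rfl⟩, h⟩ := hx2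
    by_cases hb0 : b = 0
    · refine hz 0 (zero_mem _) 1 (one_mem _) one_ne_zero ?_
      apply hi
      simp [h, hb0]
    · refine hz a ha b hb hb0 ?_
      apply hi
      have : i b ≠ 0 := fun h0 => hb0 (hi (by simpa using h0))
      rw [map_mul, h]
      exact div_mul_cancel₀ _ this
  obtain ⟨M, _, _, j₁, j₂, hj⟩ := aux_two_emb F L (i z) hzF
  let T := TensorProduct K D D
  let _ : Algebra K M := ((algebraMap F M).comp (algebraMap K F)).toAlgebra
  have : IsScalarTower K F M := IsScalarTower.of_algebraMap_eq (fun x => rfl)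
  let f₁ : D →ₐ[K] M := (j₁.restrictScalars K).comp i
  let f₂ : D →ₐ[K] M := (j₂.restrictScalars K).comp i
  let Θ : T →ₐ[K] M := Algebra.TensorProduct.productMap f₁ f₂
  let l : D →ₐ[K] T := Algebra.TensorProduct.includeLeft
  let r : D →ₐ[K] T := Algebra.TensorProduct.includeRight
  have hl : ∀ x, Θ (l x) = f₁ x := fun x =>
    Algebra.TensorProduct.productMap_left_apply f₁ f₂ x
  have hr : ∀ x, Θ (r x) = f₂ x := fun x =>
    Algebra.TensorProduct.productMap_right_apply f₁ f₂ x
  have hf₁ : Function.Injective f₁ := j₁.toRingHom.injective.comp hi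
  have hf₂ : Function.Injective f₂ := j₂.toRingHom.injective.comp hi
  let e : T := (l z - r z) * (l g * r g)
  have he : Θ e ≠ 0 := by
    simp only [e, map_mul, map_sub, hl, hr]
    refine mul_ne_zero (sub_ne_zero.2 hj) (mul_ne_zero ?_ ?_)
    · exact fun h => hg (hf₁ (by simpa using h))
    · exact fun h => hg (hf₂ (by simpa using h))
  have : Algebra.FiniteType K T := Algebra.FiniteType.trans (S := D) inferInstance inferInstance
  have : IsJacobsonRing T := isJacobsonRing_of_finiteType (A := K)
  let p : Ideal T := RingHom.ker Θ
  have hp : p.IsPrime := RingHom.ker_isPrime _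
  have hjac : p.jacobson = p := IsJacobsonRing.out inferInstance hp.isRadical
  have hep : e ∉ p.jacobson := by rw [hjac]; exact he
  simp only [Ideal.jacobson, Ideal.mem_sInf, not_forall] at hep
  obtain ⟨m, ⟨hpm, hm⟩, hem⟩ := hep
  let _ : Field (T ⧸ m) := Ideal.Quotient.field m
  have : Module.Finite K (T ⧸ m) := finite_of_finite_type_of_isJacobsonRing K (T ⧸ m)
  have hbij : Function.Bijective (algebraMap K (T ⧸ m)) :=
    IsAlgClosed.algebraMap_bijective_of_isIntegral
  let ε : K ≃ₐ[K] (T ⧸ m) := AlgEquiv.ofBijective (Algebra.ofId K (T ⧸ m)) hbij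
  let q : T →ₐ[K] K := (ε.symm : (T ⧸ m) →ₐ[K] K).comp (Ideal.Quotient.mkₐ K m)
  have hq : ∀ t, q t = 0 ↔ t ∈ m := by
    intro t
    simp [q, Ideal.Quotient.eq_zero_iff_mem]
  have hqe : q e ≠ 0 := fun h => hem ((hq e).1 h)
  simp only [e, map_mul, map_sub] at hqe
  refine ⟨q.comp l, q.comp r, fun a ha => ?_, ?_, ?_, ?_⟩
  · have : l a - r a ∈ m := by
      apply hpm
      change Θ (l a - r a) = 0
      rw [map_sub, hl, hr]
      have hmem : i a ∈ F := IntermediateField.subset_adjoin _ _ ⟨a, ha, rfl⟩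
      have e1 : f₁ a = algebraMap F M ⟨i a, hmem⟩ := j₁.commutes ⟨i a, hmem⟩
      have e2 : f₂ a = algebraMap F M ⟨i a, hmem⟩ := j₂.commutes ⟨i a, hmem⟩
      rw [e1, e2, sub_self]
    have := (hq _).2 this
    rw [map_sub] at this
    exact sub_eq_zero.1 this
  · exact sub_ne_zero.1 (left_ne_zero_of_mul hqe)
  · exact left_ne_zero_of_mul (right_ne_zero_of_mul hqe)
  · exact right_ne_zero_of_mul (right_ne_zero_of_mul hqe)


theorem aux_dim_transfer (K S D : Type) [Field K] [CommRing S] [Algebra K S]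
    [Algebra.FiniteType K S] [CommRing D] [IsDomain D] [Algebra K D] [Algebra.FiniteType K D]
    (h : S →ₐ[K] D) (T : Set D) (hT : Algebra.adjoin K T = ⊤)
    (hx : ∀ x ∈ T, ∃ a b : S, h b ≠ 0 ∧ x * h b = h a) :
    ringKrullDim D = ringKrullDim h.range := by
  have : Algebra.FiniteType K h.range :=
    Algebra.FiniteType.of_surjective h.rangeRestrict h.rangeRestrict_surjective
  have hle : T ⊆ ((Subalgebra.algebraicClosure h.range D).restrictScalars K : Subalgebra K D) := by
    intro x hxT
    obtain ⟨a, b, hb, hab⟩ := hx x hxT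
    change IsAlgebraic h.range x
    refine ⟨Polynomial.C ⟨h b, b, rfl⟩ * Polynomial.X - Polynomial.C ⟨h a, a, rfl⟩, ?_, ?_⟩
    · intro h0
      have := congrArg (fun p => Polynomial.coeff p 1) h0
      simp at this
      exact hb (congrArg Subtype.val this)
    · simp only [map_sub, map_mul, Polynomial.aeval_C, Polynomial.aeval_X]
      change h b * x - h a = 0
      rw [mul_comm, hab, sub_self]
  have halg : Algebra.IsAlgebraic h.range D := by
    constructor
    intro x
    have hxx : x ∈ Algebra.adjoin K T := by rw [hT]; trivial
    exact Algebra.adjoin_le hle hxx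
  obtain ⟨s, hs, hs'⟩ := aux_dim_eq K D
  obtain ⟨t, ht, ht'⟩ := aux_dim_eq K h.range
  have := trdeg_add_eq K h.range (A := D)
  rw [trdeg_eq_zero (R := h.range) (A := D), ht, hs] at this
  rw [hs', ht']
  have hst : t = s := by simpa using this
  rw [hst]

theorem aux_quot (S E : Type) [CommRing S] [IsDomain S] [CommRing E] (h : S →+* E)
    (hs : Function.Surjective h) (x : S) (hx : x ≠ 0) (hx0 : h x = 0) :
    ringKrullDim E + 1 ≤ ringKrullDim S := by
  refine le_trans ?_ (ringKrullDim_quotient_succ_le_of_nonZeroDivisor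
    (mem_nonZeroDivisors_of_ne_zero hx))
  gcongr
  refine ringKrullDim_le_of_surjective (Ideal.Quotient.lift (Ideal.span {x}) h ?_) ?_
  · intro a ha
    obtain ⟨c, rfl⟩ := Ideal.mem_span_singleton'.1 ha
    simp [hx0]
  · exact Ideal.Quotient.lift_surjective_of_surjective _ _ hs

theorem aux_quot2 (S E : Type) [CommRing S] [IsDomain S] [CommRing E] (h : S →+* E)
    (hs : Function.Surjective h) (p x : S) (hp : Prime p) (hp0 : h p = 0)
    (hx : ¬ p ∣ x) (hx0 : h x = 0) :
    ringKrullDim E + 1 + 1 ≤ ringKrullDim S := by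
  have : (Ideal.span {p}).IsPrime := (Ideal.span_singleton_prime hp.ne_zero).2 hp
  have hl : ∀ a ∈ Ideal.span {p}, h a = 0 := by
    intro a ha
    obtain ⟨c, rfl⟩ := Ideal.mem_span_singleton'.1 ha
    simp [hp0]
  refine le_trans ?_ (aux_quot S (S ⧸ Ideal.span {p}) (Ideal.Quotient.mk _)
    Ideal.Quotient.mk_surjective p hp.ne_zero (by simp))
  gcongr
  refine aux_quot _ E (Ideal.Quotient.lift (Ideal.span {p}) h hl)
    (Ideal.Quotient.lift_surjective_of_surjective _ _ hs) (Ideal.Quotient.mk _ x) ?_ (by simpa)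
  rw [Ne, Ideal.Quotient.eq_zero_iff_mem, Ideal.mem_span_singleton]
  exact hx

theorem aux_prime_dim (W : Type) [CommRing W] (n : ℕ) (h : (n : WithBot ℕ∞) ≤ ringKrullDim W) :
    ∃ q : Ideal W, q.IsPrime ∧ (n : WithBot ℕ∞) ≤ ringKrullDim (W ⧸ q) := by
  obtain ⟨l, hl⟩ := Order.le_krullDim_iff.1 h
  refine ⟨l.head.asIdeal, l.head.isPrime, ?_⟩
  rw [ringKrullDim_quotient]
  refine Order.le_krullDim_iff.2 ⟨⟨l.length, fun i => ⟨l i, ?_⟩, fun i => ?_⟩, hl⟩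
  · exact l.head_le i
  · exact l.step i

theorem aux_prime_factor (S : Type) [CommRing S] [IsDomain S] [UniqueFactorizationMonoid S]
    (P : Ideal S) [P.IsPrime] (G : S) (hG : G ≠ 0) (hGP : G ∈ P) :
    ∃ p, Prime p ∧ p ∣ G ∧ p ∈ P := by
  have h := UniqueFactorizationMonoid.factors_prod hG
  have h2 : (UniqueFactorizationMonoid.factors G).prod ∈ P := by
    obtain ⟨u, hu⟩ := h.symm
    rw [← hu]
    exact P.mul_mem_right _ hGP
  obtain ⟨p, hp, hpP⟩ := (Ideal.IsPrime.multiset_prod_mem_iff_exists_mem ‹_› _).1 h2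
  exact ⟨p, UniqueFactorizationMonoid.prime_of_factor p hp,
    UniqueFactorizationMonoid.dvd_of_mem_factors hp, hpP⟩

theorem aux_homcomp_aeval (K : Type) [Field K] (N k : ℕ)
    (y : Fin k → MvPolynomial (Fin N) K) (hy : ∀ i, (y i).IsHomogeneous 1)
    (F : MvPolynomial (Fin k) K) (d : ℕ) :
    homogeneousComponent d (aeval y F) = aeval y (homogeneousComponent d F) := by
  have h : ∀ e, (aeval y (homogeneousComponent e F)) ∈ homogeneousSubmodule (Fin N) K e := by
    intro e
    have := (homogeneousComponent_isHomogeneous e F).aeval y hy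
    rwa [one_mul] at this
  conv_lhs => rw [← sum_homogeneousComponent F]
  rw [map_sum, map_sum]
  simp_rw [homogeneousComponent_of_mem (h _)]
  rw [Finset.sum_ite_eq]
  split_ifs with hd
  · rfl
  · rw [homogeneousComponent_eq_zero d F (by simpa using hd), map_zero]

theorem aux_homcomp_X_mul (K : Type) [Field K] (N : ℕ) (i : Fin N)
    (F : MvPolynomial (Fin N) K) :
    homogeneousComponent 1 (X i * F) = X i * C (constantCoeff F) := by
  have h : ∀ e, (X i * homogeneousComponent e F) ∈ homogeneousSubmodule (Fin N) K (e + 1) := by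
    intro e
    have := (isHomogeneous_X K i).mul (homogeneousComponent_isHomogeneous e F)
    rwa [add_comm] at this
  conv_lhs => rw [← sum_homogeneousComponent F]
  rw [Finset.mul_sum, map_sum]
  simp_rw [homogeneousComponent_of_mem (h _)]
  rw [Finset.sum_eq_single 0]
  · simp [homogeneousComponent_zero, constantCoeff_eq]
  · intro b _ hb
    rw [if_neg (by omega)]
  · simp

theorem aux_alg_main (K : Type) [Field K] (N n : ℕ) (hn : 2 ≤ n)
    (I : Ideal (MvPolynomial (Fin N) K)) [hIp : I.IsPrime]
    (hI : ∀ f ∈ I, ∀ d, homogeneousComponent d f ∈ I)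
    (y : Fin (n + 1) → MvPolynomial (Fin N) K) (hy : ∀ i, (y i).IsHomogeneous 1)
    (m : Ideal (MvPolynomial (Fin N) K ⧸ I)) [m.IsPrime]
    (hym : ∀ i, Ideal.Quotient.mk I (y i) ∈ m)
    (hht : ((n + 1 : ℕ) : ℕ∞) ≤ m.height)
    (LM : ∀ (D : Type) [CommRing D] [IsDomain D] [Algebra K D]
      (f : MvPolynomial (Fin N) K →ₐ[K] D), Function.Surjective f → (∀ x ∈ I, f x = 0) →
      2 ≤ ringKrullDim D → ∀ i, ∃ F G : MvPolynomial (Fin (n + 1)) K,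
        f (aeval y G) ≠ 0 ∧ f (X i) * f (aeval y G) = f (aeval y F)) (i : Fin N) :
    ∃ (c : K) (F : MvPolynomial (Fin (n + 1)) K), c ≠ 0 ∧ F.IsHomogeneous 1 ∧
      X i * C c - aeval y F ∈ I := by
  have hdimS : ringKrullDim (MvPolynomial (Fin (n + 1)) K) = ((n + 1 : ℕ) : WithBot ℕ∞) := by
    rw [MvPolynomial.ringKrullDim_of_isNoetherianRing]; simp
  have key : ∀ (D : Type) [CommRing D] [IsDomain D] [Algebra K D]
      (f : MvPolynomial (Fin N) K →ₐ[K] D), Function.Surjective f → (∀ x ∈ I, f x = 0) →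
      2 ≤ ringKrullDim D → ringKrullDim D = ringKrullDim (f.comp (aeval y)).range := by
    intro D _ _ _ f hf hfI hD
    have : Algebra.FiniteType K D := Algebra.FiniteType.of_surjective f hf
    refine aux_dim_transfer K _ D (f.comp (aeval y)) (Set.range fun i => f (X i)) ?_ ?_
    · have : (Set.range fun i => f (X i)) = f '' (Set.range X) := by
        rw [← Set.range_comp]; rfl
      rw [this, ← AlgHom.map_adjoin, adjoin_range_X, Algebra.map_top]
      exact (AlgHom.range_eq_top f).2 hf
    · rintro _ ⟨i, rfl⟩
      obtain ⟨F, G, h1, h2⟩ := LM D f hf hfI hD i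
      exact ⟨F, G, h1, h2⟩
  let R := MvPolynomial (Fin N) K ⧸ I
  let π : MvPolynomial (Fin N) K →ₐ[K] R := Ideal.Quotient.mkₐ K I
  have hπ : Function.Surjective π := Ideal.Quotient.mkₐ_surjective K I
  have hπI : ∀ x ∈ I, π x = 0 := fun x hx => Ideal.Quotient.eq_zero_iff_mem.2 hx
  have hdimR : ((n + 1 : ℕ) : WithBot ℕ∞) ≤ ringKrullDim R :=
    le_trans (by exact_mod_cast hht) (Ideal.height_le_ringKrullDim_of_isPrime (I := m))
  have h2R : 2 ≤ ringKrullDim R := le_trans (by exact_mod_cast (by omega : 2 ≤ n + 1)) hdimR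
  have hinj : ∀ G : MvPolynomial (Fin (n + 1)) K, G ≠ 0 → π (aeval y G) ≠ 0 := by
    intro G hG h0
    have h1 := aux_quot _ _ (π.comp (aeval y)).rangeRestrict.toRingHom
      (AlgHom.rangeRestrict_surjective _) G hG (Subtype.ext h0)
    rw [hdimS] at h1
    have h3 := key R π hπ hπI h2R
    rw [h3] at hdimR
    have h4 : ((n + 1 : ℕ) : WithBot ℕ∞) + 1 ≤ ((n + 1 : ℕ) : WithBot ℕ∞) :=
      le_trans (by gcongr) h1
    have : n + 1 + 1 ≤ n + 1 := by exact_mod_cast h4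
    omega
  obtain ⟨F₀, G₀, hG₀, hFG₀⟩ := LM R π hπ hπI h2R i
  have hG₀0 : G₀ ≠ 0 := by rintro rfl; simp at hG₀
  obtain ⟨G, F, c, hrel, rfl, rfl⟩ := UniqueFactorizationMonoid.exists_reduced_factors G₀ hG₀0 F₀
  have hG0 : G ≠ 0 := right_ne_zero_of_mul hG₀0
  have hc0 : c ≠ 0 := left_ne_zero_of_mul hG₀0
  have hFG : π (X i) * π (aeval y G) = π (aeval y F) := by
    apply mul_left_cancel₀ (hinj c hc0)
    simp only [map_mul] at hFG₀
    rw [← hFG₀]; ring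
  have hmem : X i * aeval y G - aeval y F ∈ I := by
    rw [← Ideal.Quotient.eq_zero_iff_mem]
    change π _ = 0
    rw [map_sub, map_mul, hFG, sub_self]
  by_cases hG00 : constantCoeff G = 0
  · exfalso
    have : (RingHom.ker (constantCoeff : MvPolynomial (Fin (n + 1)) K →+* K)).IsPrime :=
      RingHom.ker_isPrime _
    obtain ⟨p, hp, hpG, hp0⟩ := aux_prime_factor _
      (RingHom.ker (constantCoeff : MvPolynomial (Fin (n + 1)) K →+* K)) G hG0 hG00
    have hpF : ¬ p ∣ F := fun h => hp.not_isUnit (hrel hpG h)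
    have hp0 : constantCoeff p = 0 := hp0
    have hym' : ∀ q : MvPolynomial (Fin (n + 1)) K,
        π (aeval y q) - π (C (constantCoeff q)) ∈ m := by
      intro q
      induction q using MvPolynomial.induction_on with
      | C a => simp
      | add p q hp hq =>
        have := m.add_mem hp hq
        simp only [map_add] at this ⊢
        convert this using 1
        ring
      | mul_X p i hp =>
        simp only [map_mul, aeval_X, constantCoeff_X, mul_zero, map_zero, sub_zero]
        exact m.mul_mem_left _ (hym i)
    have hpm : π (aeval y p) ∈ m := by simpa [hp0] using hym' p
    have hk := Ideal.height_le_ringKrullDim_quotient_add_one hpm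
    have hW : (n : WithBot ℕ∞) ≤ ringKrullDim (R ⧸ Ideal.span {π (aeval y p)}) := by
      have : ((n : ℕ) : WithBot ℕ∞) + 1 ≤ ringKrullDim (R ⧸ Ideal.span {π (aeval y p)}) + 1 :=
        le_trans (by exact_mod_cast hht) hk
      exact ENat.WithBot.add_le_add_one_right_iff.1 this
    obtain ⟨q, hq, hqd⟩ := aux_prime_dim (R ⧸ Ideal.span {π (aeval y p)}) n hW
    let W := R ⧸ Ideal.span {π (aeval y p)}
    let f : MvPolynomial (Fin N) K →ₐ[K] (W ⧸ q) :=
      (Ideal.Quotient.mkₐ K q).comp ((Ideal.Quotient.mkₐ K (Ideal.span {π (aeval y p)})).comp π)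
    have hf : Function.Surjective f := (Ideal.Quotient.mkₐ_surjective K q).comp
      ((Ideal.Quotient.mkₐ_surjective K _).comp hπ)
    have hfπ : ∀ a b, π a = π b → f a = f b := by
      intro a b h
      simp only [f, AlgHom.comp_apply, h]
    have hfI : ∀ x ∈ I, f x = 0 := by
      intro x hx
      rw [hfπ x 0 (by rw [hπI x hx, map_zero]), map_zero]
    have h2 : 2 ≤ ringKrullDim (W ⧸ q) := le_trans (by exact_mod_cast hn) hqd
    have hkey := key (W ⧸ q) f hf hfI h2
    have hfp : f (aeval y p) = 0 := by
      have : Ideal.Quotient.mkₐ K (Ideal.span {π (aeval y p)}) (π (aeval y p)) = 0 :=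
        Ideal.Quotient.eq_zero_iff_mem.2 (Ideal.mem_span_singleton_self _)
      simp only [f, AlgHom.comp_apply, this, map_zero]
    have hfG : f (aeval y G) = 0 := by
      obtain ⟨e, rfl⟩ := hpG
      simp only [map_mul, hfp, zero_mul]
    have hfF : f (aeval y F) = 0 := by
      rw [← hfπ (X i * aeval y G) (aeval y F) (by rw [map_mul, hFG]), map_mul, hfG, mul_zero]
    have h1 := aux_quot2 _ _ (f.comp (aeval y)).rangeRestrict.toRingHom
      (AlgHom.rangeRestrict_surjective _) p F hp (Subtype.ext hfp) hpF (Subtype.ext hfF)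
    rw [hdimS, ← hkey] at h1
    have h4 : ((n : ℕ) : WithBot ℕ∞) + 1 + 1 ≤ ((n + 1 : ℕ) : WithBot ℕ∞) :=
      le_trans (by gcongr) h1
    have : n + 1 + 1 ≤ n + 1 := by exact_mod_cast h4
    omega
  · refine ⟨constantCoeff G, homogeneousComponent 1 F, hG00,
      homogeneousComponent_isHomogeneous 1 F, ?_⟩
    have h := hI _ hmem 1
    rw [map_sub, aux_homcomp_X_mul, aux_homcomp_aeval K N _ y hy] at h
    have hcc : constantCoeff (aeval y G) = constantCoeff G := by
      have := aux_homcomp_aeval K N _ y hy G 0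
      rw [homogeneousComponent_zero, homogeneousComponent_zero, aeval_C] at this
      exact C_injective _ _ this
    rwa [hcc] at h

/-- The vanishing ideal of the affine cone over a set of projective points. -/
def coneIdeal {N : ℕ} (C : Set (PS K N)) : Ideal (MvPolynomial (Fin N) K) where
  carrier := {f | ∀ v : Fin N → K, ∀ hv : v ≠ 0, Projectivization.mk K v hv ∈ C → eval v f = 0}
  add_mem' := by
    intro a b ha hb v hv hC
    rw [map_add, ha v hv hC, hb v hv hC, add_zero]
  zero_mem' := by
    intro v hv hC
    exact map_zero _
  smul_mem' := by
    intro c x hx v hv hC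
    rw [smul_eq_mul, map_mul, hx v hv hC, mul_zero]

theorem mem_coneIdeal {N : ℕ} (C : Set (PS K N)) (f : MvPolynomial (Fin N) K) :
    f ∈ coneIdeal K C ↔
      ∀ v : Fin N → K, ∀ hv : v ≠ 0, Projectivization.mk K v hv ∈ C → eval v f = 0 := Iff.rfl

theorem eval_smul_hom {N : ℕ} (f : MvPolynomial (Fin N) K) (d : ℕ) (hf : f.IsHomogeneous d)
    (t : K) (v : Fin N → K) : eval (t • v) f = t ^ d * eval v f := by
  rw [eval_eq', eval_eq', Finset.mul_sum]
  refine Finset.sum_congr rfl fun m hm => ?_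
  have hd : ∑ i, m i = d := by
    have := hf.degree_eq_sum_deg_support hm
    rw [this]
    exact (Finset.sum_subset (Finset.subset_univ _) (by simp)).symm
  simp only [Pi.smul_apply, smul_eq_mul, mul_pow, Finset.prod_mul_distrib,
    Finset.prod_pow_eq_pow_sum, hd]
  ring

theorem coneIdeal_hom [Infinite K] {N : ℕ} (C : Set (PS K N)) (f : MvPolynomial (Fin N) K)
    (hf : f ∈ coneIdeal K C) (d : ℕ) : homogeneousComponent d f ∈ coneIdeal K C := by
  intro v hv hC
  let q : Polynomial K := ∑ e ∈ Finset.range (f.totalDegree + 1),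
    Polynomial.C (eval v (homogeneousComponent e f)) * Polynomial.X ^ e
  have hq : ∀ t : K, t ≠ 0 → q.IsRoot t := by
    intro t ht
    have htv : t • v ≠ 0 := smul_ne_zero ht hv
    have h1 : Projectivization.mk K (t • v) htv = Projectivization.mk K v hv :=
      (Projectivization.mk_eq_mk_iff' K _ _ _ _).2 ⟨t, rfl⟩
    have h2 := hf (t • v) htv (h1 ▸ hC)
    rw [← sum_homogeneousComponent f, map_sum] at h2
    simp only [Polynomial.IsRoot, q, Polynomial.eval_finsetSum, Polynomial.eval_mul,
      Polynomial.eval_C, Polynomial.eval_pow, Polynomial.eval_X]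
    rw [← h2]
    refine Finset.sum_congr rfl fun e _ => ?_
    rw [eval_smul_hom K _ e (homogeneousComponent_isHomogeneous e f), mul_comm]
  have hq0 : q = 0 := by
    apply Polynomial.eq_zero_of_infinite_isRoot
    exact (Set.finite_singleton (0 : K)).infinite_compl.mono fun t ht => hq t ht
  by_cases hd : d < f.totalDegree + 1
  · have := congrArg (fun p => Polynomial.coeff p d) hq0
    simpa [q, Polynomial.finsetSum_coeff, Polynomial.coeff_C_mul_X_pow, hd,
      Nat.lt_succ_iff.1 hd] using this
  · rw [homogeneousComponent_eq_zero d f (by omega), map_zero]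

theorem mem_zeros_of_hom {N : ℕ} (f : MvPolynomial (Fin N) K) (d : ℕ) (hf : f.IsHomogeneous d)
    (v : Fin N → K) (hv : v ≠ 0) (h : eval v f = 0) : Projectivization.mk K v hv ∈ zeros K f := by
  intro w hw hwv
  obtain ⟨t, rfl⟩ := (Projectivization.mk_eq_mk_iff' K _ _ _ _).1 hwv
  rw [eval_smul_hom K f d hf, h, mul_zero]

theorem zeros_closed {N : ℕ} (f : MvPolynomial (Fin N) K) (d : ℕ) (hf : f.IsHomogeneous d) :
    IsZClosed K (zeros K f) :=
  ⟨{f}, by rintro _ rfl; exact ⟨d, hf⟩, by simp⟩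

theorem coneIdeal_le_iff {N : ℕ} (C : Set (PS K N)) (f : MvPolynomial (Fin N) K) :
    f ∈ coneIdeal K C ↔ C ⊆ zeros K f := by
  constructor
  · intro h p hp v hv hvp
    exact h v hv (hvp ▸ hp)
  · intro h v hv hC
    exact h hC v hv rfl

theorem mem_of_closed {N : ℕ} (C : Set (PS K N)) (hC : IsZClosed K C) (v : Fin N → K)
    (hv : v ≠ 0) (h : ∀ f ∈ coneIdeal K C, eval v f = 0) : Projectivization.mk K v hv ∈ C := by
  obtain ⟨F, hF, rfl⟩ := hC
  simp only [Set.mem_iInter]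
  intro f hf
  obtain ⟨d, hd⟩ := hF f hf
  refine mem_zeros_of_hom K f d hd v hv (h f ?_)
  rw [coneIdeal_le_iff]
  exact Set.biInter_subset_of_mem hf

theorem coneIdeal_mono {N : ℕ} {C C' : Set (PS K N)} (h : C ⊆ C') :
    coneIdeal K C' ≤ coneIdeal K C :=
  fun _ hf v hv hC => hf v hv (h hC)

theorem coneIdeal_lt {N : ℕ} {C C' : Set (PS K N)} (hC : IsZClosed K C) (h : C ⊂ C') :
    coneIdeal K C' < coneIdeal K C := by
  refine lt_of_le_of_ne (coneIdeal_mono K h.1) fun heq => h.2 ?_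
  intro p hp
  induction p using Projectivization.ind with
  | h v hv =>
    refine mem_of_closed K C hC v hv fun f hf => ?_
    rw [← heq] at hf
    exact hf v hv hp

theorem coneIdeal_prime [Infinite K] {N : ℕ} (C : Set (PS K N)) (hC : IsIrredClosed K C) :
    (coneIdeal K C).IsPrime := by
  let _ := MvPolynomial.gradedAlgebra (σ := Fin N) (R := K)
  refine Ideal.IsHomogeneous.isPrime_of_homogeneous_mem_or_mem
    (𝒜 := homogeneousSubmodule (Fin N) K) ?_ ?_ ?_
  · intro d f hf
    have := coneIdeal_hom K C f hf d
    convert this using 1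
    exact decomposition.decompose'_apply f d
  · obtain ⟨p, hp⟩ := hC.1
    intro h
    have h1 : (1 : MvPolynomial (Fin N) K) ∈ coneIdeal K C := by rw [h]; trivial
    have := h1 p.rep p.rep_nonzero (by rw [Projectivization.mk_rep]; exact hp)
    simp at this
  · rintro x y ⟨d, hx⟩ ⟨e, hy⟩ hxy
    rw [coneIdeal_le_iff, coneIdeal_le_iff]
    refine hC.2.2 _ _ (zeros_closed K x d hx) (zeros_closed K y e hy) ?_
    intro p hp
    induction p using Projectivization.ind with
    | h v hv =>
      have := hxy v hv hp
      rw [map_mul] at this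
      rcases mul_eq_zero.1 this with h | h
      · exact Or.inl (mem_zeros_of_hom K x d hx v hv h)
      · exact Or.inr (mem_zeros_of_hom K y e hy v hv h)

theorem coneIdeal_lt_irr [Infinite K] {N : ℕ} (C : Set (PS K N)) (hC : C.Nonempty) :
    coneIdeal K C < RingHom.ker (constantCoeff : MvPolynomial (Fin N) K →+* K) := by
  obtain ⟨p, hp⟩ := hC
  have hp' : Projectivization.mk K p.rep p.rep_nonzero ∈ C := by
    rw [Projectivization.mk_rep]; exact hp
  rw [SetLike.lt_iff_le_and_exists]
  constructor
  · intro f hf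
    have := coneIdeal_hom K C f hf 0 p.rep p.rep_nonzero hp'
    rw [homogeneousComponent_zero, eval_C] at this
    exact this
  · obtain ⟨j, hj⟩ := Function.ne_iff.1 p.rep_nonzero
    refine ⟨X j, by simp [RingHom.mem_ker], fun h => hj ?_⟩
    simpa using h p.rep p.rep_nonzero hp'

theorem exists_chain {N : ℕ} (X : Set (PS K N)) (n : ℕ) (hn : 2 ≤ n) (h : zdim K X = n) :
    ∃ C : Fin (n + 1) → Set (PS K N),
    (∀ i, IsIrredClosed K (C i) ∧ C i ⊆ X) ∧
    ∀ i j : Fin (n + 1), i < j → C i ⊂ C j := by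
  unfold zdim at h
  have hb : BddAbove {m | ∃ C : Fin (m + 1) → Set (PS K N),
    (∀ i, IsIrredClosed K (C i) ∧ C i ⊆ X) ∧
    ∀ i j : Fin (m + 1), i < j → C i ⊂ C j} := by
    by_contra hb
    rw [Nat.sSup_of_not_bddAbove hb] at h
    omega
  have hne : {m | ∃ C : Fin (m + 1) → Set (PS K N),
    (∀ i, IsIrredClosed K (C i) ∧ C i ⊆ X) ∧
    ∀ i j : Fin (m + 1), i < j → C i ⊂ C j}.Nonempty := by
    by_contra hne
    rw [Set.not_nonempty_iff_eq_empty.1 hne, csSup_empty] at h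
    simp at h
    omega
  have := Nat.sSup_mem hne hb
  rw [h] at this
  exact this

theorem exists_height [Infinite K] {N : ℕ} (X : Set (PS K N))
    (n : ℕ) (hn : 2 ≤ n) (h : zdim K X = n) :
    ∃ m : Ideal (MvPolynomial (Fin N) K ⧸ coneIdeal K X), m.IsPrime ∧
      (∀ f, constantCoeff f = 0 → Ideal.Quotient.mk (coneIdeal K X) f ∈ m) ∧
      ((n + 1 : ℕ) : ℕ∞) ≤ m.height := by
  obtain ⟨C, hC, hlt⟩ := exists_chain K X n hn h
  let I := coneIdeal K X
  let mk := Ideal.Quotient.mk I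
  have hsurj : Function.Surjective mk := Ideal.Quotient.mk_surjective
  have hmp : ∀ Q : Ideal (MvPolynomial (Fin N) K), Q.IsPrime → I ≤ Q → (Q.map mk).IsPrime := by
    intro Q hQ hle
    exact Ideal.map_isPrime_of_surjective hsurj (by rw [Ideal.mk_ker]; exact hle)
  have hcm : ∀ Q : Ideal (MvPolynomial (Fin N) K), I ≤ Q → (Q.map mk).comap mk = Q := by
    intro Q hle
    rw [Ideal.comap_map_of_surjective mk hsurj, ← RingHom.ker_eq_comap_bot, Ideal.mk_ker]
    exact sup_eq_left.2 hle
  have hmlt : ∀ Q Q' : Ideal (MvPolynomial (Fin N) K), I ≤ Q → Q < Q' → Q.map mk < Q'.map mk := by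
    intro Q Q' hle hlt
    refine lt_of_le_of_ne (Ideal.map_mono hlt.le) fun heq => hlt.ne ?_
    rw [← hcm Q hle, heq, hcm Q' (hle.trans hlt.le)]
  have hle : ∀ i, I ≤ coneIdeal K (C i) := fun i => coneIdeal_mono K (hC i).2
  let g : Fin (n + 1) → PrimeSpectrum (MvPolynomial (Fin N) K ⧸ I) := fun i =>
    ⟨(coneIdeal K (C i)).map mk, hmp _ (coneIdeal_prime K (C i) (hC i).1) (hle i)⟩
  have hg : ∀ k : ℕ, ∀ hk : k ≤ n, (k : ℕ∞) ≤ Order.height (g ⟨n - k, by omega⟩) := by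
    intro k
    induction k with
    | zero => simp
    | succ k ih =>
      intro hk
      have h1 := ih (by omega)
      have h2 : g ⟨n - k, by omega⟩ < g ⟨n - (k + 1), by omega⟩ := by
        refine hmlt _ _ (hle _) (coneIdeal_lt K (hC _).1.2.1 (hlt _ _ ?_))
        rw [Fin.mk_lt_mk]
        omega
      refine le_trans ?_ (Order.height_add_one_le h2)
      push_cast
      gcongr
  have hlast := hlt
  have h0 := coneIdeal_lt_irr K (C 0) (hC 0).1.1
  let M := RingHom.ker (constantCoeff : MvPolynomial (Fin N) K →+* K)
  have hM : M.IsPrime := RingHom.ker_isPrime _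
  have hMm := hmp M hM ((hle 0).trans h0.le)
  refine ⟨M.map mk, hMm, fun f hf => Ideal.mem_map_of_mem mk hf, ?_⟩
  let m : PrimeSpectrum (MvPolynomial (Fin N) K ⧸ I) := ⟨M.map mk, hMm⟩
  have h3 : g 0 < m := hmlt _ _ (hle 0) h0
  have h4 := hg n le_rfl
  have h5 : (⟨n - n, by omega⟩ : Fin (n + 1)) = 0 := by
    ext; simp
  rw [h5] at h4
  have h6 := PrimeSpectrum.height_eq_orderHeight m
  change _ ≤ m.asIdeal.height
  rw [h6]
  refine le_trans ?_ (Order.height_add_one_le h3)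
  push_cast
  gcongr

theorem linear_of_hom_one {N : ℕ} (f : MvPolynomial (Fin N) K) (hf : f.IsHomogeneous 1) :
    ∃ l : (Fin N → K) →ₗ[K] K, ∀ v, l v = eval v f := by
  have hf' : f ∈ Submodule.span K (Set.range (X : Fin N → MvPolynomial (Fin N) K)) := by
    rw [← homogeneousSubmodule_one_eq_span_X]; exact hf
  induction hf' using Submodule.span_induction with
  | mem x h =>
    obtain ⟨i, rfl⟩ := h
    exact ⟨LinearMap.proj i, fun v => by simp⟩
  | zero => exact ⟨0, fun v => by simp⟩
  | add x y hx hy hx' hy' =>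
    rw [← homogeneousSubmodule_one_eq_span_X] at hx hy
    obtain ⟨l, hl⟩ := hx' hx
    obtain ⟨l', hl'⟩ := hy' hy
    exact ⟨l + l', fun v => by simp [hl, hl']⟩
  | smul a x hx hx' =>
    rw [← homogeneousSubmodule_one_eq_span_X] at hx
    obtain ⟨l, hl⟩ := hx' hx
    exact ⟨a • l, fun v => by simp [hl, smul_eval]⟩

theorem hom_one_vanish {N : ℕ} (Y : Set (PS K N)) (hY : Nondeg K Y)
    (f : MvPolynomial (Fin N) K) (hf : f.IsHomogeneous 1) (hfY : f ∈ coneIdeal K Y)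
    (v : Fin N → K) : eval v f = 0 := by
  obtain ⟨l, hl⟩ := linear_of_hom_one K f hf
  rw [← hl]
  have h : projSpan K Y ≤ LinearMap.ker l := by
    refine Submodule.span_le.2 ?_
    rintro _ ⟨p, hp, rfl⟩
    change l p.rep = 0
    rw [hl]
    exact hfY p.rep p.rep_nonzero (by rw [Projectivization.mk_rep]; exact hp)
  rw [hY] at h
  exact h (Submodule.mem_top (x := v))

/-- A linear form through the point `s`, nonzero in a quotient of dimension at least two. -/
theorem exists_form {N : ℕ} (s : PS K N) (D : Type) [CommRing D] [IsDomain D] [Algebra K D]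
    (f : MvPolynomial (Fin N) K →ₐ[K] D) (hf : Function.Surjective f)
    (hD : 2 ≤ ringKrullDim D) :
    ∃ l : MvPolynomial (Fin N) K, f l ≠ 0 ∧ ∀ c : K, eval (c • s.rep) l = 0 := by
  by_contra hcon
  push Not at hcon
  obtain ⟨j, hj⟩ := Function.ne_iff.1 s.rep_nonzero
  have hj : s.rep j ≠ 0 := hj
  have hx : ∀ i, f (X i) = algebraMap K D (s.rep i / s.rep j) * f (X j) := by
    intro i
    by_contra hne
    obtain ⟨c, hc⟩ := hcon (X i - C (s.rep i / s.rep j) * X j) (by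
      rw [map_sub, map_mul, ← algebraMap_eq, AlgHom.commutes]
      exact sub_ne_zero.2 hne)
    apply hc
    simp only [map_sub, eval_X, map_mul, eval_C, Pi.smul_apply, smul_eq_mul]
    field_simp
    ring
  let φ : Polynomial K →ₐ[K] D := Polynomial.aeval (f (X j))
  have hφ : Function.Surjective φ := by
    have hr : φ.range = ⊤ := by
      rw [eq_top_iff, ← (AlgHom.range_eq_top f).2 hf, ← Algebra.map_top, ← adjoin_range_X,
        AlgHom.map_adjoin]
      refine Algebra.adjoin_le ?_
      rintro _ ⟨_, ⟨i, rfl⟩, rfl⟩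
      refine ⟨Polynomial.C (s.rep i / s.rep j) * Polynomial.X, ?_⟩
      change φ _ = f (X i)
      rw [hx i]
      simp [φ]
    exact (AlgHom.range_eq_top φ).1 hr
  have h1 := ringKrullDim_le_of_surjective φ.toRingHom hφ
  rw [Polynomial.ringKrullDim_of_isNoetherianRing, ringKrullDim_eq_zero_of_field, zero_add] at h1
  have h2 : (2 : WithBot ℕ∞) ≤ 1 := hD.trans h1
  have h3 : (2 : ℕ) ≤ 1 := by exact_mod_cast h2
  omega

/-- The linear forms defining a linear map. -/
def forms {N k : ℕ} (π : (Fin N → K) →ₗ[K] (Fin k → K)) (i : Fin k) :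
    MvPolynomial (Fin N) K :=
  ∑ j : Fin N, MvPolynomial.C (π (Pi.single j 1) i) * MvPolynomial.X j

theorem forms_hom {N k : ℕ} (π : (Fin N → K) →ₗ[K] (Fin k → K)) (i : Fin k) :
    (forms K π i).IsHomogeneous 1 :=
  IsHomogeneous.sum _ _ _ fun j _ => isHomogeneous_C_mul_X _ j

theorem eval_forms {N k : ℕ} (π : (Fin N → K) →ₗ[K] (Fin k → K)) (i : Fin k) (v : Fin N → K) :
    eval v (forms K π i) = π v i := by
  have hv : v = ∑ j, v j • (Pi.single j 1 : Fin N → K) := by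
    ext a
    simp [Finset.sum_apply, Pi.single_apply]
  conv_rhs => rw [hv, map_sum, Finset.sum_apply]
  simp only [forms, map_sum, map_mul, eval_C, eval_X, map_smul, Pi.smul_apply, smul_eq_mul]
  exact Finset.sum_congr rfl fun j _ => mul_comm _ _

theorem eval_aeval_forms {N k : ℕ} (π : (Fin N → K) →ₗ[K] (Fin k → K))
    (F : MvPolynomial (Fin k) K) (v : Fin N → K) :
    eval v (aeval (forms K π) F) = eval (π v) F := by
  induction F using MvPolynomial.induction_on with
  | C a => simp
  | add p q hp hq => rw [map_add, map_add, map_add, hp, hq]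
  | mul_X p i hp => rw [map_mul, map_mul, map_mul, hp, aeval_X, eval_forms, eval_X]

theorem birational_lemma [IsAlgClosed K] [CharZero K] {N k : ℕ} (Y : Set (PS K N))
    (hY : IsZClosed K Y) (S : Finset (PS K N)) (hS : S.Nonempty)
    (π : (Fin N → K) →ₗ[K] (Fin k → K))
    (h1 : ∀ p : PS K N, p ∈ Y → p ∉ (S : Set (PS K N)) → π p.rep ≠ 0)
    (h2 : ∀ p q : PS K N, p ∈ Y → q ∈ Y → p ∉ (S : Set (PS K N)) → q ∉ (S : Set (PS K N)) →
        ∀ (hp : π p.rep ≠ 0) (hq : π q.rep ≠ 0),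
          Projectivization.mk K (π p.rep) hp = Projectivization.mk K (π q.rep) hq → p = q)
    (D : Type) [CommRing D] [IsDomain D] [Algebra K D]
    (f : MvPolynomial (Fin N) K →ₐ[K] D) (hf : Function.Surjective f)
    (hfI : ∀ x ∈ coneIdeal K Y, f x = 0) (hD : 2 ≤ ringKrullDim D) (i : Fin N) :
    ∃ F G : MvPolynomial (Fin k) K, f (aeval (forms K π) G) ≠ 0 ∧
      f (X i) * f (aeval (forms K π) G) = f (aeval (forms K π) F) := by
  by_contra hcon
  push Not at hcon
  have : Algebra.FiniteType K D := Algebra.FiniteType.of_surjective f hf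
  choose l hl0 hl using fun s : PS K N => exists_form K s D f hf hD
  obtain ⟨φ, ψ, hA, hz, hφg, hψg⟩ := aux_two_points K D (f.comp (aeval (forms K π))).range
    (f (X i)) (∏ s ∈ S, f (l s)) (Finset.prod_ne_zero_iff.2 fun s _ => hl0 s) (by
      rintro _ ⟨a, rfl⟩ _ ⟨b, rfl⟩ hb
      exact hcon a b hb)
  have hev : ∀ (χ : D →ₐ[K] K) (F : MvPolynomial (Fin N) K),
      eval (fun j => χ (f (X j))) F = χ (f F) := by
    intro χ F
    have : (aeval (fun j => χ (f (X j))) : MvPolynomial (Fin N) K →ₐ[K] K) = χ.comp f := by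
      apply MvPolynomial.algHom_ext
      intro j
      simp
    rw [← AlgHom.comp_apply, ← this, ← coe_aeval_eq_eval]
    rfl
  have hpt : ∀ χ : D →ₐ[K] K, χ (∏ s ∈ S, f (l s)) ≠ 0 →
      ∃ hv : (fun j => χ (f (X j))) ≠ 0, Projectivization.mk K _ hv ∈ Y ∧
        Projectivization.mk K _ hv ∉ (S : Set (PS K N)) := by
    intro χ hχ
    rw [map_prod, Finset.prod_ne_zero_iff] at hχ
    have hne : ∀ s ∈ S, ∀ c : K, (fun j => χ (f (X j))) ≠ c • s.rep := by
      intro s hs c heq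
      apply hχ s hs
      rw [← hev, heq, hl s c]
    obtain ⟨s₀, hs₀⟩ := hS
    have hv : (fun j => χ (f (X j))) ≠ 0 := by
      have := hne s₀ hs₀ 0
      rwa [zero_smul] at this
    refine ⟨hv, mem_of_closed K Y hY _ hv fun F hF => ?_, fun hmem => ?_⟩
    · rw [hev, hfI F hF, map_zero]
    · have h3 := Projectivization.mk_rep (Projectivization.mk K _ hv)
      obtain ⟨c, hc⟩ := (Projectivization.mk_eq_mk_iff' K _ _ _ _).1 h3.symm
      exact hne _ hmem c hc.symm
  obtain ⟨hv, hvY, hvS⟩ := hpt φ hφg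
  obtain ⟨hw, hwY, hwS⟩ := hpt ψ hψg
  have hπ : π (fun j => φ (f (X j))) = π (fun j => ψ (f (X j))) := by
    ext a
    rw [← eval_forms, ← eval_forms, hev, hev]
    exact hA _ ⟨X a, by simp⟩
  generalize hv' : (fun j => φ (f (X j))) = v at *
  generalize hw' : (fun j => ψ (f (X j))) = w at *
  obtain ⟨a, ha⟩ := Projectivization.exists_smul_eq_mk_rep K v hv
  obtain ⟨b, hb⟩ := Projectivization.exists_smul_eq_mk_rep K w hw
  have hp := h1 _ hvY hvS
  have hq := h1 _ hwY hwS
  have heq := h2 _ _ hvY hwY hvS hwS hp hq (by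
    rw [Projectivization.mk_eq_mk_iff']
    refine ⟨(a : K) * (b : K)⁻¹, ?_⟩
    rw [← ha, ← hb, Units.smul_def, Units.smul_def, map_smul, map_smul, hπ, smul_smul,
      inv_mul_cancel_right₀ b.ne_zero])
  obtain ⟨c, hc⟩ := (Projectivization.mk_eq_mk_iff' K _ _ _ _).1 heq
  have hπw : π w ≠ 0 := by
    intro h0
    apply hq
    rw [← hb, Units.smul_def, map_smul, h0, smul_zero]
  have hc1 : c = 1 := by
    rw [← hc, map_smul] at hπ
    have : (c - 1) • π w = 0 := by rw [sub_smul, hπ, one_smul, sub_self]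
    exact sub_eq_zero.1 ((smul_eq_zero.1 this).resolve_right hπw)
  rw [hc1, one_smul] at hc
  apply hz
  have e1 : φ (f (X i)) = v i := congrFun hv' i
  have e2 : ψ (f (X i)) = w i := congrFun hw' i
  rw [e1, e2, hc]

/-- There is no smooth integral non-degenerate `X ⊆ ℙ^r` of dimension `n`
with `2 ≤ n < r` admitting a linear projection that is an injective morphism
`X ∖ S → ℙ^n` off a nonempty finite set `S` of `a−1` points. -/
theorem statement17 [IsAlgClosed K] [CharZero K] (r n a : ℕ) (hn : 2 ≤ n) (hnr : n < r)
    (ha : 2 ≤ a) :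
    ¬ ∃ (X : Set (PS K (r + 1))) (S : Finset (PS K (r + 1)))
        (π : (Fin (r + 1) → K) →ₗ[K] (Fin (n + 1) → K)),
      SmoothVariety K X ∧ zdim K X = n ∧ ↑S ⊆ X ∧ S.card = a - 1 ∧
      Function.Surjective π ∧
      (∀ p : PS K (r + 1), p ∈ X → p ∉ (S : Set (PS K (r + 1))) → π p.rep ≠ 0) ∧
      (∀ p q : PS K (r + 1), p ∈ X → q ∈ X → p ∉ (S : Set (PS K (r + 1))) →
        q ∉ (S : Set (PS K (r + 1))) →
        ∀ (hp : π p.rep ≠ 0) (hq : π q.rep ≠ 0),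
          Projectivization.mk K (π p.rep) hp = Projectivization.mk K (π q.rep) hq →
            p = q) := by
  rintro ⟨Y, S, π, ⟨⟨hirr, hnd⟩, -⟩, hdim, -, hcard, -, h1, h2⟩
  have hS : S.Nonempty := by
    rw [← Finset.card_pos]
    omega
  have hprime := coneIdeal_prime K Y hirr
  obtain ⟨m, hm, hmem, hht⟩ := exists_height K Y n hn hdim
  have key := aux_alg_main K (r + 1) n hn (coneIdeal K Y) (coneIdeal_hom K Y) (forms K π)
    (forms_hom K π) m (fun i => hmem _ (by
      have := eval_forms K π i 0
      rw [map_zero] at this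
      rw [← eval_zero]
      exact this)) hht
    (fun D _ _ _ f hf hfI hD i => birational_lemma K Y hirr.2.1 S hS π h1 h2 D f hf hfI hD i)
  have hinj : Function.Injective π := by
    rw [← LinearMap.ker_eq_bot, LinearMap.ker_eq_bot']
    intro v hv
    ext i
    obtain ⟨c, F, hc, hF, hmemI⟩ := key i
    have hh : (X i * C c - aeval (forms K π) F : MvPolynomial (Fin (r + 1)) K).IsHomogeneous 1 := by
      refine IsHomogeneous.sub ?_ ?_
      · exact (isHomogeneous_X K i).mul (isHomogeneous_C _ c)
      · have := hF.aeval (forms K π) (forms_hom K π)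
        rwa [one_mul] at this
    have h0 := hom_one_vanish K Y hnd _ hh hmemI v
    obtain ⟨l, hl⟩ := linear_of_hom_one K F hF
    rw [map_sub, map_mul, eval_X, eval_C, eval_aeval_forms, hv, ← hl, map_zero, sub_zero] at h0
    exact (mul_eq_zero.1 h0).resolve_right hc
  have := LinearMap.finrank_le_finrank_of_injective hinj
  simp at this
  omega

end Dep
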